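/- For every fixed integer k ≥ 3, there exists n_0 = n_0(k) such that for all n ≥ n_0, the polynomial P_{n,k}(x) = ∑_{j=0}^{k} C(n, j) x^j is irreducible over ℚ. -/

import Mathlib

/-- The rising product `(x + 1) (x + 2) ⋯ (x + n)`. -/
noncomputable def risingProd (x : ℝ) (n : ℕ) : ℝ := ∏ t ∈ Finset.range n, (x + 1 + t)

/-- The generalized binomial coefficient `(x + r choose j)`, meant for `j ≤ r`. -/
noncomputable def shiftedBinom (x : ℝ) (r j : ℕ) : ℝ :=
  (∏ t ∈ Finset.range j, (x + 1 + (r - j : ℕ) + t)) / j.factorial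

/-- The Padé polynomials for `w ↦ w ^ x` at `w = 1`:
`padePoly x r w * w ^ x - padePoly (-x) r w` vanishes to order `2 * r + 1` at `1`. -/
noncomputable def padePoly (x : ℝ) (r : ℕ) : Polynomial ℝ :=
  ∑ j ∈ Finset.range (r + 1),
    Polynomial.C (shiftedBinom x r (r - j) * shiftedBinom (-x) r j) * Polynomial.X ^ j

lemma risingProd_pos {x : ℝ} (hx : -1 < x) (n : ℕ) : 0 < risingProd x n :=
  Finset.prod_pos fun t _ => by positivity [show 0 < x + 1 by linarith]

lemma risingProd_zero (n : ℕ) : risingProd 0 n = n.factorial := by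
  rw [risingProd, ← Finset.prod_range_add_one_eq_factorial]
  push_cast
  exact Finset.prod_congr rfl fun t _ => by ring

lemma shiftedBinom_pos {x : ℝ} (hx : -1 < x) (r j : ℕ) : 0 < shiftedBinom x r j := by
  have : 0 < x + 1 := by linarith
  exact div_pos (Finset.prod_pos fun t _ => by positivity) (by positivity)

lemma shiftedBinom_eq {x : ℝ} (hx : -1 < x) {r j : ℕ} (hj : j ≤ r) :
    shiftedBinom x r j = risingProd x r / (risingProd x (r - j) * j.factorial) := by
  have h : risingProd x r
      = risingProd x (r - j) * ∏ t ∈ Finset.range j, (x + 1 + (r - j : ℕ) + t) := by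
    conv_lhs => rw [show r = (r - j) + j by omega]
    rw [risingProd, Finset.prod_range_add, risingProd]
    congr 1
    exact Finset.prod_congr rfl fun t _ => by push_cast; ring
  have := risingProd_pos hx (r - j)
  rw [shiftedBinom, h]
  field_simp

lemma shiftedBinom_le {x : ℝ} (hx : -1 < x) (hx1 : x < 1) {r j : ℕ} (hj : j ≤ r) :
    shiftedBinom x r j ≤ 2 ^ (r + 1) := by
  have hx0 : 0 < x + 1 := by linarith
  have h1 : shiftedBinom x r j ≤ ((r + 1).choose j : ℝ) := by
    rw [shiftedBinom, div_le_iff₀ (by positivity)]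
    have h2 : ((r + 1).choose j * j.factorial : ℝ)
        = ∏ t ∈ Finset.range j, ((2 + (r - j) : ℕ) + t : ℝ) := by
      have h3 := Nat.ascFactorial_eq_factorial_mul_choose (1 + (r - j)) j
      rw [Nat.ascFactorial_eq_prod_range, show 1 + (r - j) + j = r + 1 by omega] at h3
      rw [mul_comm]
      exact_mod_cast h3.symm.trans (Finset.prod_congr rfl fun t _ => by ring)
    rw [h2]
    refine Finset.prod_le_prod (fun t _ => by positivity) fun t _ => ?_
    push_cast
    linarith
  refine h1.trans ?_
  exact_mod_cast Nat.choose_le_two_pow _ _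

lemma prod_erase_sub (x : ℝ) {r j : ℕ} (hj : j ≤ r) :
    ∏ i ∈ (Finset.range (r + 1)).erase j, ((j : ℝ) + x - i)
      = risingProd x j * ((-1) ^ (r - j) * risingProd (-x) (r - j)) := by
  have h : (Finset.range (r + 1)).erase j
      = Finset.range j ∪ Finset.Ico (j + 1) (r + 1) := by
    ext i; simp; omega
  rw [h, Finset.prod_union]
  · congr 1
    · rw [← Finset.prod_range_reflect, risingProd]
      refine Finset.prod_congr rfl fun t ht => ?_
      have ht' : t < j := Finset.mem_range.mp ht
      rw [show j - 1 - t = j - (1 + t) by omega, Nat.cast_sub (by omega)]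
      push_cast; ring
    · rw [Finset.prod_Ico_eq_prod_range, show r + 1 - (j + 1) = r - j by omega, risingProd,
        ← Finset.card_range (r - j), ← Finset.prod_const, Finset.card_range,
        ← Finset.prod_mul_distrib]
      exact Finset.prod_congr rfl fun t _ => by push_cast; ring
  · rw [Finset.disjoint_left]
    intro i hi hi'
    simp at hi hi'
    omega

lemma prod_range_sub (x : ℝ) {r j : ℕ} (hj : j ≤ r) :
    ∏ i ∈ Finset.range (r + 1), ((j : ℝ) + x - i)
      = x * (risingProd x j * ((-1) ^ (r - j) * risingProd (-x) (r - j))) := by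
  rw [← prod_erase_sub x hj,
    ← Finset.mul_prod_erase _ _ (Finset.mem_range.mpr (by omega : j < r + 1))]
  congr 1
  ring

lemma pade_moment {ν : ℝ} (h0 : 0 < ν) (h1 : ν < 1) {r m : ℕ} (hm : m ≤ 2 * r) :
    ∑ j ∈ Finset.range (r + 1), shiftedBinom ν r (r - j) * shiftedBinom (-ν) r j * (j + ν) ^ m
      = ∑ j ∈ Finset.range (r + 1),
        shiftedBinom (-ν) r (r - j) * shiftedBinom ν r j * (j : ℝ) ^ m := by
  set s : Finset (ℕ ⊕ ℕ) := (Finset.range (r + 1)).disjSum (Finset.range (r + 1)) with hs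
  set v : ℕ ⊕ ℕ → ℝ := Sum.elim (fun i => (i : ℝ)) (fun i => (i : ℝ) + ν) with hv
  have hne : ∀ i j : ℕ, (i : ℝ) ≠ j + ν := by
    intro i j h
    have h2 : (j : ℝ) < i := by linarith
    have h3 : (i : ℝ) < (j + 1 : ℕ) := by push_cast; linarith
    have h2' : j < i := by exact_mod_cast h2
    have h3' : i < j + 1 := by exact_mod_cast h3
    omega
  have hinj : Set.InjOn v s := by
    rintro (a | a) - (b | b) - h
    · simpa [hv] using h
    · exact absurd h (hne a b)
    · exact absurd h.symm (hne b a)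
    · simpa [hv] using h
  have hcard : s.card = 2 * r + 2 := by
    rw [hs, Finset.card_disjSum, Finset.card_range]; ring
  have key := Lagrange.coeff_eq_sum (P := Polynomial.X ^ m) hinj (by
    rw [Polynomial.degree_X_pow, hcard]; exact_mod_cast (by omega : m < 2 * r + 2))
  rw [hcard, Polynomial.coeff_X_pow, if_neg (by omega), hs, Finset.sum_disjSum] at key
  have eL : ∀ j, ((Finset.range (r + 1)).disjSum (Finset.range (r + 1))).erase (Sum.inl j)
      = ((Finset.range (r + 1)).erase j).disjSum (Finset.range (r + 1)) := by
    intro j; ext (a | a) <;> simp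
  have eR : ∀ j, ((Finset.range (r + 1)).disjSum (Finset.range (r + 1))).erase (Sum.inr j)
      = (Finset.range (r + 1)).disjSum ((Finset.range (r + 1)).erase j) := by
    intro j; ext (a | a) <;> simp
  set M := ν * risingProd (-ν) r * risingProd ν r with hM
  have hp := risingProd_pos (x := ν) (by linarith)
  have hn := risingProd_pos (x := -ν) (by linarith)
  have hMpos : 0 < M := mul_pos (mul_pos h0 (hn r)) (hp r)
  have hL : ∀ j ∈ Finset.range (r + 1),
      (Polynomial.X ^ m : Polynomial ℝ).eval (v (Sum.inl j)) /
        ∏ i ∈ ((Finset.range (r + 1)).disjSum (Finset.range (r + 1))).erase (Sum.inl j),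
          (v (Sum.inl j) - v i)
      = -(shiftedBinom (-ν) r (r - j) * shiftedBinom ν r j * (j : ℝ) ^ m) / M := by
    intro j hj
    have hj' : j ≤ r := by simpa [Nat.lt_succ_iff] using hj
    rw [eL, Finset.prod_disjSum]
    have p1 := prod_erase_sub 0 hj'
    have p2 : ∏ i ∈ Finset.range (r + 1), ((j : ℝ) - (i + ν)) = _ :=
      (Finset.prod_congr rfl fun t _ => by ring).trans (prod_range_sub (-ν) hj')
    rw [neg_neg] at p2
    simp only [hv, Sum.elim_inl, Sum.elim_inr, Polynomial.eval_pow, Polynomial.eval_X]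
    rw [show ∏ i ∈ (Finset.range (r + 1)).erase j, ((j : ℝ) - i) = _ by simpa using p1, p2,
      shiftedBinom_eq (by linarith) (Nat.sub_le _ _), shiftedBinom_eq (by linarith) hj',
      Nat.sub_sub_self hj', hM, risingProd_zero, risingProd_zero]
    have := hp r; have := hn r; have := hn j; have := hp (r - j)
    have hsq : ((-1 : ℝ) ^ (r - j)) * (-1) ^ (r - j) = 1 := by rw [← mul_pow]; simp
    field_simp
    rw [pow_two, hsq, mul_one]
  have hR : ∀ j ∈ Finset.range (r + 1),
      (Polynomial.X ^ m : Polynomial ℝ).eval (v (Sum.inr j)) /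
        ∏ i ∈ ((Finset.range (r + 1)).disjSum (Finset.range (r + 1))).erase (Sum.inr j),
          (v (Sum.inr j) - v i)
      = (shiftedBinom ν r (r - j) * shiftedBinom (-ν) r j * (j + ν) ^ m) / M := by
    intro j hj
    have hj' : j ≤ r := by simpa [Nat.lt_succ_iff] using hj
    rw [eR, Finset.prod_disjSum]
    have p1 := prod_erase_sub 0 hj'
    have p2 := prod_range_sub ν hj'
    simp only [hv, Sum.elim_inl, Sum.elim_inr, Polynomial.eval_pow, Polynomial.eval_X,
      add_sub_add_right_eq_sub]
    rw [show ∏ i ∈ (Finset.range (r + 1)).erase j, ((j : ℝ) - i) = _ by simpa using p1, p2,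
      shiftedBinom_eq (by linarith) (Nat.sub_le _ _), shiftedBinom_eq (by linarith) hj',
      Nat.sub_sub_self hj', hM, risingProd_zero, risingProd_zero]
    have := hp r; have := hn r; have := hp j; have := hn (r - j)
    have hsq : ((-1 : ℝ) ^ (r - j)) * (-1) ^ (r - j) = 1 := by rw [← mul_pow]; simp
    field_simp
    rw [pow_two, hsq]
  rw [Finset.sum_congr rfl hL, Finset.sum_congr rfl hR, ← Finset.sum_div, ← Finset.sum_div,
    ← add_div, eq_comm, div_eq_zero_iff, or_iff_left hMpos.ne', Finset.sum_neg_distrib] at key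
  linarith

lemma exp_sub_sum_le {s t : ℝ} (hs : 0 ≤ s) (ht : 0 ≤ t) (ht1 : t ≤ 1) (n : ℕ) :
    Real.exp (s * t) - ∑ m ∈ Finset.range n, (s * t) ^ m / m.factorial ≤ t ^ n * Real.exp s := by
  have hsum := Real.summable_pow_div_factorial (s * t)
  have hsum' := Real.summable_pow_div_factorial s
  have e1 : Real.exp (s * t) - ∑ m ∈ Finset.range n, (s * t) ^ m / m.factorial
      = ∑' m, (s * t) ^ (m + n) / (m + n).factorial := by
    rw [Real.exp_eq_exp_ℝ, NormedSpace.exp_eq_tsum_div]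
    simp only [← hsum.sum_add_tsum_nat_add n]
    ring
  have e2 : ∑' m, s ^ (m + n) / (m + n).factorial ≤ Real.exp s := by
    rw [Real.exp_eq_exp_ℝ, NormedSpace.exp_eq_tsum_div]
    simp only [← hsum'.sum_add_tsum_nat_add n]
    exact le_add_of_nonneg_left (Finset.sum_nonneg fun i _ => by positivity)
  rw [e1]
  refine le_trans ?_ (mul_le_mul_of_nonneg_left e2 (by positivity))
  rw [← tsum_mul_left]
  refine Summable.tsum_le_tsum (fun m => ?_) ((summable_nat_add_iff n).mpr hsum)
    (((summable_nat_add_iff n).mpr hsum').mul_left _)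
  rw [mul_pow, mul_comm, ← mul_div_assoc]
  have : t ^ (m + n) ≤ t ^ n := pow_le_pow_of_le_one ht ht1 (by omega)
  gcongr

lemma abs_exp_neg_sub_sum_le {s t : ℝ} (hs : 0 ≤ s) (ht : 0 ≤ t) (ht1 : t ≤ 1) (n : ℕ) :
    |Real.exp (s * -t) - ∑ m ∈ Finset.range n, (s * -t) ^ m / m.factorial|
      ≤ t ^ n * Real.exp s := by
  have h := Complex.norm_exp_sub_sum_le_exp_norm_sub_sum ((s * -t : ℝ) : ℂ) n
  have h2 : ‖((s * -t : ℝ) : ℂ)‖ = s * t := by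
    rw [Complex.norm_real, Real.norm_eq_abs, abs_mul, abs_neg, abs_of_nonneg hs, abs_of_nonneg ht]
  rw [h2] at h
  refine le_trans (le_of_eq ?_) (h.trans (exp_sub_sum_le hs ht ht1 n))
  rw [← Real.norm_eq_abs, ← Complex.norm_real]
  push_cast
  rfl

lemma eval_padePoly (x w : ℝ) (r : ℕ) : (padePoly x r).eval w
    = ∑ j ∈ Finset.range (r + 1), shiftedBinom x r (r - j) * shiftedBinom (-x) r j * w ^ j := by
  simp [padePoly, Polynomial.eval_finsetSum]

lemma sum_shiftedBinom_mul_le {x : ℝ} (h0 : -1 < x) (h1 : x < 1) (r : ℕ) :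
    ∑ j ∈ Finset.range (r + 1), shiftedBinom x r (r - j) * shiftedBinom (-x) r j
      ≤ 8 ^ (r + 1) := by
  have h : ∀ j ∈ Finset.range (r + 1), shiftedBinom x r (r - j) * shiftedBinom (-x) r j
      ≤ 2 ^ (r + 1) * 2 ^ (r + 1) := fun j hj =>
    mul_le_mul (shiftedBinom_le h0 h1 (Nat.sub_le _ _))
      (shiftedBinom_le (by linarith) (by linarith) (by simpa [Nat.lt_succ_iff] using hj))
      (shiftedBinom_pos (by linarith) _ _).le (by positivity)
  refine (Finset.sum_le_sum h).trans ?_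
  rw [Finset.sum_const, Finset.card_range, nsmul_eq_mul]
  have h2 : ((r + 1 : ℕ) : ℝ) ≤ 2 ^ (r + 1) := by exact_mod_cast Nat.lt_two_pow_self.le
  calc ((r + 1 : ℕ) : ℝ) * (2 ^ (r + 1) * 2 ^ (r + 1))
      ≤ 2 ^ (r + 1) * (2 ^ (r + 1) * 2 ^ (r + 1)) := by gcongr
    _ = 8 ^ (r + 1) := by rw [← mul_pow, ← mul_pow]; norm_num

lemma padePoly_eval_le {x w : ℝ} (h0 : -1 < x) (h1 : x < 1) (hw : 0 ≤ w) (hw1 : w ≤ 1) (r : ℕ) :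
    (padePoly x r).eval w ≤ 8 ^ (r + 1) := by
  rw [eval_padePoly]
  refine le_trans (Finset.sum_le_sum fun j _ => ?_) (sum_shiftedBinom_mul_le h0 h1 r)
  have := mul_pos (shiftedBinom_pos h0 r (r - j)) (shiftedBinom_pos (x := -x) (by linarith) r j)
  exact mul_le_of_le_one_right this.le (pow_le_one₀ hw hw1)

lemma padePoly_eval_pos {x w : ℝ} (h0 : -1 < x) (h1 : x < 1) (hw : 0 < w) (r : ℕ) :
    0 < (padePoly x r).eval w := by
  rw [eval_padePoly]
  exact Finset.sum_pos (fun j _ => mul_pos (mul_pos (shiftedBinom_pos h0 r (r - j))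
    (shiftedBinom_pos (by linarith) r j)) (by positivity)) (by simp)

lemma pade_remainder {ν w : ℝ} (h0 : 0 < ν) (h1 : ν < 1) (hw : 1 / 2 ≤ w) (hw1 : w ≤ 1) (r : ℕ) :
    |(padePoly ν r).eval w * w ^ ν - (padePoly (-ν) r).eval w|
      ≤ 4 * 216 ^ (r + 1) * (1 - w) ^ (2 * r + 1) := by
  have hw0 : 0 < w := by linarith
  set t := -Real.log w with ht
  have ht0 : 0 ≤ t := by have := Real.log_nonpos hw0.le hw1; linarith
  have htle : t ≤ 2 * (1 - w) := by
    have h := Real.one_sub_inv_le_log_of_pos hw0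
    have : w⁻¹ ≤ 1 + 2 * (1 - w) := by
      rw [inv_le_iff_one_le_mul₀ hw0]; nlinarith
    linarith
  have ht1 : t ≤ 1 := by linarith
  set n := 2 * r + 1 with hn
  set T : ℝ → ℝ := fun s => ∑ m ∈ Finset.range n, (s * -t) ^ m / m.factorial with hT
  have hexp : ∀ s : ℝ, w ^ s = Real.exp (s * -t) := by
    intro s; rw [Real.rpow_def_of_pos hw0, ht, neg_neg, mul_comm]
  set c : ℕ → ℝ := fun j => shiftedBinom ν r (r - j) * shiftedBinom (-ν) r j with hc
  set c' : ℕ → ℝ := fun j => shiftedBinom (-ν) r (r - j) * shiftedBinom ν r j with hc'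
  have hmom : ∑ j ∈ Finset.range (r + 1), c j * T (j + ν)
      = ∑ j ∈ Finset.range (r + 1), c' j * T j := by
    simp only [hT, Finset.mul_sum]
    rw [Finset.sum_comm, Finset.sum_comm (s := Finset.range (r + 1)) (t := Finset.range n)]
    refine Finset.sum_congr rfl fun m hm => ?_
    have hm' : m ≤ 2 * r := by simp [hn] at hm; omega
    have := congrArg (fun z => z * ((-t) ^ m / m.factorial)) (pade_moment h0 h1 hm')
    simp only [Finset.sum_mul] at this
    convert this using 2 <;> simp only [hc, hc', mul_pow] <;> ring
  have hE : (padePoly ν r).eval w * w ^ ν - (padePoly (-ν) r).eval w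
      = ∑ j ∈ Finset.range (r + 1), c j * (Real.exp ((j + ν) * -t) - T (j + ν))
        - ∑ j ∈ Finset.range (r + 1), c' j * (Real.exp (j * -t) - T j) := by
    simp only [mul_sub, Finset.sum_sub_distrib]
    rw [hmom, sub_sub_sub_cancel_right, eval_padePoly, eval_padePoly, Finset.sum_mul, neg_neg]
    congr 1
    · refine Finset.sum_congr rfl fun j _ => ?_
      rw [← hexp, Real.rpow_add hw0, Real.rpow_natCast, mul_assoc]
    · refine Finset.sum_congr rfl fun j _ => ?_
      rw [← hexp, Real.rpow_natCast]
  have hb : ∀ s : ℝ, 0 ≤ s → s ≤ r + 1 →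
      |Real.exp (s * -t) - T s| ≤ t ^ n * Real.exp (r + 1) := fun s hs hs' =>
    (abs_exp_neg_sub_sum_le hs ht0 ht1 n).trans (by gcongr)
  have hsum : ∀ (x : ℝ) (f : ℕ → ℝ), -1 < x → x < 1 →
      (∀ j ∈ Finset.range (r + 1), |f j| ≤ t ^ n * Real.exp (r + 1)) →
      |∑ j ∈ Finset.range (r + 1), shiftedBinom x r (r - j) * shiftedBinom (-x) r j * f j|
        ≤ 8 ^ (r + 1) * (t ^ n * Real.exp (r + 1)) := by
    intro x f hx hx1 hf
    refine (Finset.abs_sum_le_sum_abs _ _).trans ?_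
    refine le_trans ?_ (mul_le_mul_of_nonneg_right (sum_shiftedBinom_mul_le hx hx1 r)
      (by positivity))
    rw [Finset.sum_mul]
    refine Finset.sum_le_sum fun j hj => ?_
    have hpos := mul_pos (shiftedBinom_pos hx r (r - j))
      (shiftedBinom_pos (x := -x) (by linarith) r j)
    rw [abs_mul, abs_of_pos hpos]
    exact mul_le_mul_of_nonneg_left (hf j hj) hpos.le
  have hjle : ∀ j ∈ Finset.range (r + 1), (j : ℝ) ≤ r := fun j hj => by
    exact_mod_cast (by simpa [Nat.lt_succ_iff] using hj : j ≤ r)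
  have b1 := hsum ν (fun j => Real.exp ((j + ν) * -t) - T (j + ν)) (by linarith) h1
    fun j hj => hb _ (by positivity) (by linarith [hjle j hj])
  have b2 := hsum (-ν) (fun j => Real.exp (j * -t) - T j) (by linarith) (by linarith)
    fun j hj => hb _ (by positivity) (by linarith [hjle j hj])
  rw [neg_neg] at b2
  rw [hE]
  refine (abs_sub _ _).trans ((add_le_add b1 b2).trans ?_)
  have he : Real.exp (r + 1) ≤ 3 ^ (r + 1) := by
    rw [show ((r : ℝ) + 1) = (r + 1 : ℕ) * (1 : ℝ) by push_cast; ring, Real.exp_nat_mul]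
    gcongr
    linarith [Real.exp_one_lt_d9]
  have htn : t ^ n ≤ 2 * 4 ^ r * (1 - w) ^ n := by
    calc t ^ n ≤ (2 * (1 - w)) ^ n := by gcongr
      _ = 2 * 4 ^ r * (1 - w) ^ n := by
        rw [mul_pow, hn, pow_succ 2, pow_mul, show (2 : ℝ) ^ 2 = 4 by norm_num]; ring
  have hw2 : 0 ≤ 1 - w := by linarith
  calc (8 : ℝ) ^ (r + 1) * (t ^ n * Real.exp (r + 1)) + 8 ^ (r + 1) * (t ^ n * Real.exp (r + 1))
      = 2 * (8 ^ (r + 1) * (t ^ n * Real.exp (r + 1))) := by ring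
    _ ≤ 2 * (8 ^ (r + 1) * ((2 * 4 ^ r * (1 - w) ^ n) * 3 ^ (r + 1))) := by gcongr
    _ = 4 * (8 ^ (r + 1) * 4 ^ r * 3 ^ (r + 1)) * (1 - w) ^ n := by ring
    _ ≤ 4 * (8 ^ (r + 1) * 9 ^ (r + 1) * 3 ^ (r + 1)) * (1 - w) ^ n := by
        have : (4 : ℝ) ^ r ≤ 9 ^ (r + 1) :=
          (pow_le_pow_left₀ (by norm_num) (by norm_num) r).trans
            (pow_le_pow_right₀ (by norm_num) (by omega))
        gcongr
    _ = 4 * 216 ^ (r + 1) * (1 - w) ^ n := by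
        rw [← mul_pow, ← mul_pow]; norm_num

lemma pow_sub_one_dvd_of_bound {D : Polynomial ℝ} {K : ℝ} {n : ℕ}
    (h : ∀ w : ℝ, 1 / 2 ≤ w → w < 1 → |D.eval w| ≤ K * (1 - w) ^ n) :
    (Polynomial.X - Polynomial.C 1) ^ n ∣ D := by
  rcases eq_or_ne D 0 with rfl | hD
  · exact dvd_zero _
  obtain ⟨E, hE, hnd⟩ := Polynomial.exists_eq_pow_rootMultiplicity_mul_and_not_dvd D hD 1
  set m := D.rootMultiplicity 1
  rcases le_or_gt n m with hm | hm
  · rw [hE]; exact (pow_dvd_pow _ hm).mul_right _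
  refine absurd ?_ hnd
  rw [Polynomial.dvd_iff_isRoot, Polynomial.IsRoot.def, ← abs_eq_zero]
  refine le_antisymm ?_ (abs_nonneg _)
  have hb : ∀ w : ℝ, 1 / 2 ≤ w → w < 1 → |E.eval w| ≤ K * (1 - w) ^ (n - m) := by
    intro w hw hw1
    have h1 := h w hw hw1
    have hpos : 0 < (1 - w) ^ m := pow_pos (by linarith) m
    rw [hE, Polynomial.eval_mul, Polynomial.eval_pow, abs_mul, abs_pow, Polynomial.eval_sub,
      Polynomial.eval_X, Polynomial.eval_C, abs_sub_comm, abs_of_pos (by linarith),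
      show n = m + (n - m) by omega, pow_add, mul_left_comm] at h1
    exact le_of_mul_le_mul_left h1 hpos
  have t1 : Filter.Tendsto (fun w => |E.eval w|) (nhdsWithin 1 (Set.Iio 1)) (nhds |E.eval 1|) :=
    (E.continuous.abs.tendsto 1).mono_left nhdsWithin_le_nhds
  have t2 : Filter.Tendsto (fun w : ℝ => K * (1 - w) ^ (n - m)) (nhdsWithin 1 (Set.Iio 1))
      (nhds 0) := by
    have hc : Continuous fun w : ℝ => K * (1 - w) ^ (n - m) := by fun_prop
    have := (hc.tendsto 1).mono_left (nhdsWithin_le_nhds (s := Set.Iio 1))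
    simpa [show n - m ≠ 0 by omega] using this
  refine le_of_tendsto_of_tendsto t1 t2 ?_
  filter_upwards [Ico_mem_nhdsLT (show (1 / 2 : ℝ) < 1 by norm_num)] with w hw
  exact hb w hw.1 hw.2

lemma natDegree_padePoly_le (x : ℝ) (r : ℕ) : (padePoly x r).natDegree ≤ r :=
  Polynomial.natDegree_sum_le_of_forall_le _ _ fun j hj =>
    (Polynomial.natDegree_C_mul_X_pow_le _ _).trans (by simpa [Nat.lt_succ_iff] using hj)

lemma coeff_padePoly (x : ℝ) (r : ℕ) :
    (padePoly x r).coeff r = risingProd (-x) r / r.factorial := by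
  simp only [padePoly, Polynomial.finsetSum_coeff, Polynomial.coeff_C_mul_X_pow]
  rw [Finset.sum_ite_eq]
  simp [shiftedBinom, risingProd]

lemma pade_det_ne_zero {ν w : ℝ} (h0 : 0 < ν) (h1 : ν < 1) (hw1 : w < 1) (r : ℕ) :
    (padePoly ν r).eval w * (padePoly (-ν) (r + 1)).eval w
      - (padePoly ν (r + 1)).eval w * (padePoly (-ν) r).eval w ≠ 0 := by
  set D := padePoly ν r * padePoly (-ν) (r + 1) - padePoly ν (r + 1) * padePoly (-ν) r with hD
  have hdeg : D.natDegree ≤ 2 * r + 1 := by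
    refine (Polynomial.natDegree_sub_le_of_le (m := 2 * r + 1) (n := 2 * r + 1) ?_ ?_).trans
      (max_self _).le
    · exact (Polynomial.natDegree_mul_le_of_le (natDegree_padePoly_le _ _)
        (natDegree_padePoly_le _ _)).trans (by omega)
    · exact (Polynomial.natDegree_mul_le_of_le (natDegree_padePoly_le _ _)
        (natDegree_padePoly_le _ _)).trans (by omega)
  have hcoeff : D.coeff (2 * r + 1) ≠ 0 := by
    rw [hD, Polynomial.coeff_sub]
    nth_rewrite 1 [show 2 * r + 1 = r + (r + 1) by ring]
    rw [show 2 * r + 1 = (r + 1) + r by ring,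
      Polynomial.coeff_mul_add_eq_of_natDegree_le (natDegree_padePoly_le _ _)
        (natDegree_padePoly_le _ _),
      Polynomial.coeff_mul_add_eq_of_natDegree_le (natDegree_padePoly_le _ _)
        (natDegree_padePoly_le _ _)]
    simp only [coeff_padePoly, neg_neg]
    have hs : ∀ x : ℝ, risingProd x (r + 1) = risingProd x r * (x + 1 + r) := fun x =>
      Finset.prod_range_succ _ _
    rw [hs, hs]
    have hp := risingProd_pos (x := ν) (by linarith) r
    have hn := risingProd_pos (x := -ν) (by linarith) r
    have : risingProd (-ν) r / r.factorial * (risingProd ν r * (ν + 1 + r) / (r + 1).factorial)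
        - risingProd (-ν) r * (-ν + 1 + r) / (r + 1).factorial * (risingProd ν r / r.factorial)
        = risingProd (-ν) r * risingProd ν r * (2 * ν) / (r.factorial * (r + 1).factorial) := by
      field_simp
      ring
    rw [this]
    positivity
  have hdvd : (Polynomial.X - Polynomial.C 1) ^ (2 * r + 1) ∣ D := by
    refine pow_sub_one_dvd_of_bound
      (K := 8 ^ (r + 2) * (4 * 216 ^ (r + 1)) + 8 ^ (r + 1) * (4 * 216 ^ (r + 2)))
      fun w hw hw1 => ?_
    have b0 := pade_remainder h0 h1 hw hw1.le r
    have b1 := pade_remainder h0 h1 hw hw1.le (r + 1)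
    have c0 := padePoly_eval_le (x := ν) (by linarith) h1 (by linarith) hw1.le r
    have c1 := padePoly_eval_le (x := ν) (by linarith) h1 (by linarith) hw1.le (r + 1)
    have p0 := padePoly_eval_pos (x := ν) (w := w) (by linarith) h1 (by linarith) r
    have p1 := padePoly_eval_pos (x := ν) (w := w) (by linarith) h1 (by linarith) (r + 1)
    have hpow : (1 - w) ^ (2 * (r + 1) + 1) ≤ (1 - w) ^ (2 * r + 1) :=
      pow_le_pow_of_le_one (by linarith) (by linarith) (by omega)
    have hw' : 0 ≤ (1 - w) ^ (2 * r + 1) := pow_nonneg (by linarith) _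
    have heq : D.eval w = (padePoly ν (r + 1)).eval w
          * ((padePoly ν r).eval w * w ^ ν - (padePoly (-ν) r).eval w)
        - (padePoly ν r).eval w
          * ((padePoly ν (r + 1)).eval w * w ^ ν - (padePoly (-ν) (r + 1)).eval w) := by
      rw [hD, Polynomial.eval_sub, Polynomial.eval_mul, Polynomial.eval_mul]; ring
    rw [heq]
    refine (abs_sub _ _).trans ?_
    rw [abs_mul, abs_mul, abs_of_pos p0, abs_of_pos p1, add_mul]
    refine add_le_add ?_ ?_
    · rw [mul_assoc]
      exact mul_le_mul c1 b0 (abs_nonneg _) (by positivity)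
    · rw [mul_assoc]
      refine mul_le_mul c0 (b1.trans ?_) (abs_nonneg _) (by positivity)
      gcongr
  obtain ⟨E, hE⟩ := hdvd
  have hmonic : ((Polynomial.X - Polynomial.C (1 : ℝ)) ^ (2 * r + 1)).Monic :=
    (Polynomial.monic_X_sub_C 1).pow _
  have hD0 : D ≠ 0 := fun h => hcoeff (by rw [h, Polynomial.coeff_zero])
  have hE0 : E ≠ 0 := fun h => hD0 (by rw [hE, h, mul_zero])
  have hEdeg : E.natDegree = 0 := by
    have := hmonic.natDegree_mul' hE0
    rw [← hE, Polynomial.natDegree_pow, Polynomial.natDegree_X_sub_C] at this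
    omega
  obtain ⟨e, rfl⟩ := Polynomial.natDegree_eq_zero.mp hEdeg
  have he : e ≠ 0 := fun h => hE0 (by rw [h, Polynomial.C_0])
  have : D.eval w = (w - 1) ^ (2 * r + 1) * e := by rw [hE]; simp
  rw [← Polynomial.eval_mul, ← Polynomial.eval_mul, ← Polynomial.eval_sub, ← hD, this]
  exact mul_ne_zero (pow_ne_zero _ (by linarith)) he

lemma factorial_dvd_pow_mul_prod (d : ℕ) (u : ℤ) (j : ℕ) :
    (j.factorial : ℤ) ∣ (d : ℤ) ^ j * ∏ t ∈ Finset.range j, (u + d * t) := by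
  rw [Int.natCast_dvd, Nat.dvd_iff_prime_pow_dvd_dvd]
  intro p k hp hk
  rw [← Int.natCast_dvd]
  have := Fact.mk hp
  by_cases hpd : p ∣ d
  · have h1 : k ≤ j := ((padicValNat_dvd_iff_le j.factorial_ne_zero).mp hk).trans
      (padicValNat_factorial_le (p := p) j)
    refine Dvd.dvd.mul_right ?_ _
    exact_mod_cast (pow_dvd_pow p h1).trans (pow_dvd_pow_of_dvd hpd j)
  · have hcop : IsCoprime (d : ℤ) ((p ^ k : ℕ) : ℤ) :=
      Nat.isCoprime_iff_coprime.mpr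
        ((Nat.Coprime.pow_left k ((Nat.Prime.coprime_iff_not_dvd hp).mpr hpd)).symm)
    obtain ⟨a, b, hab⟩ := hcop
    set q : ℤ := ((p ^ k : ℕ) : ℤ) with hq
    have hq0 : q ≠ 0 := by rw [hq]; exact_mod_cast (pow_pos hp.pos k).ne'
    obtain ⟨N, hN⟩ := Int.eq_ofNat_of_zero_le (Int.emod_nonneg (a * u) hq0)
    have hmod : ∀ t ∈ Finset.range j, u + d * (t : ℤ) ≡ d * ((N + t : ℕ) : ℤ) [ZMOD q] := by
      intro t _
      rw [Int.modEq_iff_dvd]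
      refine ⟨-(d * (a * u / q) + u * b), ?_⟩
      have h2 := Int.mul_ediv_add_emod (a * u) q
      rw [hN] at h2
      push_cast
      have h3 : (N : ℤ) = a * u - q * (a * u / q) := by linarith
      linear_combination (d : ℤ) * h3 + u * hab
    have hprod := Int.ModEq.prod hmod
    refine Dvd.dvd.mul_left ?_ _
    refine (Int.ModEq.dvd_iff hprod).mpr ?_
    rw [Finset.prod_mul_distrib]
    refine Dvd.dvd.mul_left ?_ _
    rw [← Nat.cast_prod, ← Nat.ascFactorial_eq_prod_range]
    rw [hq, Int.natCast_dvd_natCast]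
    exact hk.trans (Nat.factorial_dvd_ascFactorial N j)

lemma exists_int_pow_mul_shiftedBinom {d : ℕ} (hd : d ≠ 0) (e : ℤ) {r j : ℕ} :
    ∃ z : ℤ, (d : ℝ) ^ (2 * j) * shiftedBinom (e / d) r j = z := by
  obtain ⟨z, hz⟩ := factorial_dvd_pow_mul_prod d (e + d * (1 + (r - j : ℕ))) j
  refine ⟨z, ?_⟩
  have hd' : (d : ℝ) ≠ 0 := by exact_mod_cast hd
  have hz' := congrArg (Int.cast : ℤ → ℝ) hz
  push_cast at hz'
  have h : (d : ℝ) ^ j * ∏ t ∈ Finset.range j, ((e : ℝ) / d + 1 + (r - j : ℕ) + t)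
      = ∏ t ∈ Finset.range j, ((e : ℝ) + d * (1 + (r - j : ℕ)) + d * t) := by
    rw [Finset.pow_eq_prod_const, ← Finset.prod_mul_distrib]
    exact Finset.prod_congr rfl fun t _ => by field_simp; ring
  rw [← h] at hz'
  rw [shiftedBinom, ← mul_div_assoc, div_eq_iff (by positivity), mul_comm (z : ℝ), ← hz']
  ring

lemma exists_int_pow_mul_padePoly {d : ℕ} (hd : d ≠ 0) (e : ℤ) (r A B : ℕ) (hB : B ≠ 0) :
    ∃ z : ℤ, (d : ℝ) ^ (2 * r) * (B : ℝ) ^ r * (padePoly (e / d) r).eval ((A : ℝ) / B) = z := by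
  choose f hf using fun r j => exists_int_pow_mul_shiftedBinom hd e (r := r) (j := j)
  choose g hg using fun r j => exists_int_pow_mul_shiftedBinom hd (-e) (r := r) (j := j)
  refine ⟨∑ j ∈ Finset.range (r + 1), f r (r - j) * g r j * A ^ j * B ^ (r - j), ?_⟩
  rw [eval_padePoly, Finset.mul_sum]
  push_cast
  refine Finset.sum_congr rfl fun j hj => ?_
  obtain ⟨i, rfl⟩ := Nat.exists_eq_add_of_le (show j ≤ r by simpa [Nat.lt_succ_iff] using hj)
  have hB' : (B : ℝ) ≠ 0 := by exact_mod_cast hB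
  rw [← hf, ← hg, Nat.add_sub_cancel_left]
  push_cast
  rw [neg_div, div_pow]
  field_simp
  ring

lemma exists_bound_of_forall_one_le {E N K₁ K₂ : ℝ} (hE : 1 ≤ E) (hN : E ^ 3 < N)
    (hK₁ : 1 ≤ K₁) :
    ∃ B : ℝ, ∀ x : ℝ, 1 ≤ x →
      (∀ r : ℕ, 1 ≤ K₁ * x * (E / N) ^ r + K₂ * (E * N) ^ (r + 1) / x ^ 2) → x ≤ B := by
  have hE0 : 0 < E := by linarith
  have hN0 : 0 < N := lt_trans (by positivity) hN
  have hEN : E < N := lt_of_le_of_lt (le_self_pow₀ hE (by norm_num)) hN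
  have hρ : 1 < N / E := by rwa [one_lt_div hE0]
  have hσ : 1 < N / E ^ 3 := by rwa [one_lt_div (by positivity)]
  obtain ⟨M, hM⟩ := pow_unbounded_of_one_lt (8 * K₁ ^ 2 * K₂ * (E * N) ^ 2) hσ
  refine ⟨(N / E) ^ M, fun x hx h => ?_⟩
  have hx0 : 0 < x := by linarith
  obtain ⟨n, hn1, hn2⟩ := exists_nat_pow_near (show 1 ≤ 2 * K₁ * x by nlinarith) hρ
  have h1 := h (n + 1)
  have hsmall : K₁ * x * (E / N) ^ (n + 1) ≤ 1 / 2 := by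
    rw [show E / N = (N / E)⁻¹ by rw [inv_div], inv_pow, ← div_eq_mul_inv,
      div_le_iff₀ (by positivity)]
    linarith
  have hbig : x ^ 2 ≤ 2 * (K₂ * (E * N) ^ (n + 2)) := by
    have : 1 / 2 ≤ K₂ * (E * N) ^ (n + 1 + 1) / x ^ 2 := by linarith
    rw [le_div_iff₀ (by positivity)] at this
    linarith
  have hsq : ((N / E) ^ n) ^ 2 ≤ (2 * K₁ * x) ^ 2 := by gcongr
  have hfin : (N / E ^ 3) ^ n ≤ 8 * K₁ ^ 2 * K₂ * (E * N) ^ 2 := by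
    have h2 : ((N / E) ^ n) ^ 2 ≤ 4 * K₁ ^ 2 * (2 * (K₂ * (E * N) ^ (n + 2))) := by
      refine hsq.trans ?_
      rw [show (2 * K₁ * x) ^ 2 = 4 * K₁ ^ 2 * x ^ 2 by ring]
      gcongr
    have h3 : ((N / E) ^ n) ^ 2 = (N / E ^ 3) ^ n * (E * N) ^ n := by
      rw [← pow_mul, mul_comm n 2, pow_mul, ← mul_pow]
      congr 1
      field_simp
    rw [h3, pow_add] at h2
    refine le_of_mul_le_mul_right (h2.trans (le_of_eq ?_)) (show 0 < (E * N) ^ n by positivity)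
    ring
  have hnM : n < M := by
    by_contra! hcon
    exact absurd (hM.trans_le (pow_le_pow_right₀ hσ.le hcon)) (not_lt.mpr hfin)
  calc x ≤ 2 * K₁ * x := by nlinarith
    _ ≤ (N / E) ^ (n + 1) := hn2.le
    _ ≤ (N / E) ^ M := pow_le_pow_right₀ hρ.le hnM

lemma sub_mul_sq_le {u v c : ℝ} {d : ℕ} (hd : 3 ≤ d) (hu : 1 ≤ u) (hv : 0 ≤ v)
    (h0 : v ^ d ≤ u ^ d) (h : u ^ d - v ^ d ≤ c) : 0 ≤ u - v ∧ (u - v) * u ^ 2 ≤ c := by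
  have huv : v ≤ u := le_of_pow_le_pow_left₀ (by omega) (by linarith) h0
  refine ⟨by linarith, le_trans ?_ h⟩
  obtain ⟨m, rfl⟩ := Nat.exists_eq_add_of_le (show 1 ≤ d by omega)
  have h1 : v ^ m ≤ u ^ m := pow_le_pow_left₀ hv huv m
  have h2 : u ^ 2 ≤ u ^ m := pow_le_pow_right₀ hu (by omega)
  rw [pow_add, pow_add, pow_one, pow_one]
  nlinarith [mul_le_mul_of_nonneg_left h2 (sub_nonneg.mpr huv), mul_le_mul_of_nonneg_left h1 hv]

/-- A sufficiently large solution of `a * x ^ d = b * y ^ d + c` bounds all the other ones. -/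
lemma thue_bounded {d a b c : ℕ} (hd : 3 ≤ d) (ha : 0 < a) (hb : 0 < b) (hc : 0 < c)
    {x₀ y₀ : ℕ} (hy₀ : 0 < y₀) (hsol : a * x₀ ^ d = b * y₀ ^ d + c)
    (hlarge : (216 * d ^ 2 * c ^ 2) ^ 3 < a * x₀ ^ d) :
    ∃ B : ℕ, ∀ x y : ℕ, 0 < y → a * x ^ d = b * y ^ d + c → x ≤ B := by
  have hx₀ : 0 < x₀ := by
    rcases Nat.eq_zero_or_pos x₀ with rfl | h
    · rw [zero_pow (by omega)] at hlarge; omega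
    · exact h
  have haR : (0 : ℝ) < a := by exact_mod_cast ha
  have ha1 : (1 : ℝ) ≤ a := by exact_mod_cast ha
  have hbR : (0 : ℝ) < b := by exact_mod_cast hb
  have hcR : (1 : ℝ) ≤ c := by exact_mod_cast hc
  have hdR : (3 : ℝ) ≤ d := by exact_mod_cast hd
  have hx₀R : (1 : ℝ) ≤ x₀ := by exact_mod_cast hx₀
  have hy₀R : (0 : ℝ) < y₀ := by exact_mod_cast hy₀
  set E : ℝ := 216 * d ^ 2 * c ^ 2 with hE
  set N : ℝ := a * x₀ ^ d with hN
  set ν : ℝ := 1 / d with hν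
  set θ : ℝ := ((b : ℝ) / a) ^ ν with hθ
  set w : ℝ := b * y₀ ^ d / N with hw
  have hν0 : 0 < ν := by positivity
  have hν1 : ν < 1 := by rw [hν, div_lt_one (by linarith)]; linarith
  have hN0 : 0 < N := by positivity
  have hEN3 : E ^ 3 < N := by rw [hE, hN]; exact_mod_cast hlarge
  have hEge : 2 * c ≤ E := by
    have hc0 : (0 : ℝ) < c := by linarith
    rw [hE]
    nlinarith [mul_pos hc0 hc0, mul_self_nonneg ((d : ℝ) - 3)]
  have hE1 : 1 ≤ E := by linarith
  have hEN : E < N := lt_of_le_of_lt (le_self_pow₀ hE1 (by norm_num)) hEN3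
  have hsolR : N = b * y₀ ^ d + c := by rw [hN]; exact_mod_cast hsol
  have h1w : 1 - w = c / N := by
    rw [hw, eq_div_iff hN0.ne', sub_mul, div_mul_cancel₀ _ hN0.ne']; linarith
  have hw0 : 0 < w := by positivity
  have hw1 : w < 1 := by
    have : 0 < (c : ℝ) / N := by positivity
    linarith
  have hwhalf : 1 / 2 ≤ w := by
    have : (c : ℝ) / N ≤ 1 / 2 := by rw [div_le_iff₀ hN0]; linarith
    linarith
  have hθd : θ ^ d = b / a := by
    rw [hθ, hν, one_div, Real.rpow_inv_natCast_pow (by positivity) (by omega)]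
  have hθ0 : 0 < θ := by positivity
  have hwν : w ^ ν * x₀ = θ * y₀ := by
    have h1 : w = (θ * y₀ / x₀) ^ d := by
      rw [div_pow, mul_pow, hθd, hw, hN]; field_simp
    rw [h1, hν, one_div, Real.pow_rpow_inv_natCast (by positivity) (by omega)]
    field_simp
  have hBne : a * x₀ ^ d ≠ 0 := by positivity
  have hwcast : ((b * y₀ ^ d : ℕ) : ℝ) / ((a * x₀ ^ d : ℕ) : ℝ) = w := by
    rw [hw, hN]; push_cast; rfl
  have hNcast : ((a * x₀ ^ d : ℕ) : ℝ) = N := by rw [hN]; push_cast; rfl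
  choose q hq using fun r =>
    exists_int_pow_mul_padePoly (show d ≠ 0 by omega) 1 r (b * y₀ ^ d) (a * x₀ ^ d) hBne
  choose p hp using fun r =>
    exists_int_pow_mul_padePoly (show d ≠ 0 by omega) (-1) r (b * y₀ ^ d) (a * x₀ ^ d) hBne
  rw [hwcast, hNcast] at hq hp
  simp only [Int.cast_one, ← hν] at hq
  simp only [Int.cast_neg, Int.cast_one, neg_div, ← hν] at hp
  have hqabs : ∀ r, |(q r : ℝ)| ≤ 8 * (E * N) ^ r := by
    intro r
    have h1 := padePoly_eval_le (by linarith) hν1 hw0.le hw1.le r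
    have h2 := padePoly_eval_pos (by linarith) hν1 hw0 r
    rw [← hq, abs_of_nonneg (by positivity), pow_mul]
    calc ((d : ℝ) ^ 2) ^ r * N ^ r * (padePoly ν r).eval w
        ≤ ((d : ℝ) ^ 2) ^ r * N ^ r * 8 ^ (r + 1) := by gcongr
      _ = 8 * (8 * d ^ 2 * N) ^ r := by rw [mul_pow, mul_pow]; ring
      _ ≤ 8 * (E * N) ^ r := by
        have : 8 * (d : ℝ) ^ 2 ≤ E := by
          rw [hE]
          nlinarith [mul_pos (show (0:ℝ) < d by linarith) (show (0:ℝ) < d by linarith),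
            one_le_pow₀ hcR (n := 2)]
        gcongr
  have hrem : ∀ r, |(q r : ℝ) * (θ * y₀) - p r * x₀| ≤ 864 * c * x₀ * (E / N) ^ r := by
    intro r
    have h1 := pade_remainder hν0 hν1 hwhalf hw1.le r
    have h2 : (q r : ℝ) * (θ * y₀) - p r * x₀
        = (d : ℝ) ^ (2 * r) * N ^ r * x₀
          * ((padePoly ν r).eval w * w ^ ν - (padePoly (-ν) r).eval w) := by
      rw [← hq, ← hp, ← hwν]; ring
    rw [h2, abs_mul, abs_of_nonneg (by positivity)]
    calc (d : ℝ) ^ (2 * r) * N ^ r * x₀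
          * |(padePoly ν r).eval w * w ^ ν - (padePoly (-ν) r).eval w|
        ≤ (d : ℝ) ^ (2 * r) * N ^ r * x₀ * (4 * 216 ^ (r + 1) * (1 - w) ^ (2 * r + 1)) := by gcongr
      _ = 864 * c * x₀ * (E / N) ^ r / N := by
        rw [h1w, hE, div_pow, div_pow, mul_pow, mul_pow, ← pow_mul, ← pow_mul]
        field_simp
        ring
      _ ≤ 864 * c * x₀ * (E / N) ^ r := div_le_self (by positivity) (by linarith)
  have hdet : ∀ r, q r * p (r + 1) ≠ q (r + 1) * p r := by
    intro r h
    have h1 := pade_det_ne_zero hν0 hν1 hw1 r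
    have h2 : (q r : ℝ) * p (r + 1) = q (r + 1) * p r := by exact_mod_cast h
    rw [← hq, ← hq, ← hp, ← hp] at h2
    refine h1 ?_
    have h3 : ((d : ℝ) ^ (2 * r) * N ^ r * ((d : ℝ) ^ (2 * (r + 1)) * N ^ (r + 1))) ≠ 0 := by
      positivity
    refine (mul_eq_zero.mp ?_).resolve_left h3
    linear_combination h2
  obtain ⟨B, hB⟩ := exists_bound_of_forall_one_le (K₁ := 864 * c * x₀ * a) (K₂ := 8 * y₀ * c)
    hE1 hEN3 (by
      have : (1 : ℝ) ≤ c * x₀ * a := one_le_mul_of_one_le_of_one_le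
        (one_le_mul_of_one_le_of_one_le hcR hx₀R) ha1
      nlinarith)
  refine ⟨⌈B⌉₊, fun x y hy hxy => ?_⟩
  have hx : 0 < x := by
    rcases Nat.eq_zero_or_pos x with rfl | h
    · rw [zero_pow (by omega)] at hxy; omega
    · exact h
  have hxR : (1 : ℝ) ≤ x := by exact_mod_cast hx
  have hxyR : (a : ℝ) * x ^ d = b * y ^ d + c := by exact_mod_cast hxy
  have hyx : (y : ℝ) ≤ a * x := by
    have h1 : y ^ d ≤ (a * x) ^ d := by
      calc y ^ d ≤ b * y ^ d := Nat.le_mul_of_pos_left _ hb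
        _ ≤ a * x ^ d := by omega
        _ ≤ a ^ d * x ^ d := Nat.mul_le_mul_right _ (Nat.le_self_pow (by omega) _)
        _ = (a * x) ^ d := (mul_pow _ _ _).symm
    exact_mod_cast (Nat.pow_le_pow_iff_left (by omega)).mp h1
  obtain ⟨hδ0, hδ⟩ : 0 ≤ x - θ * y ∧ (x - θ * y) * (x : ℝ) ^ 2 ≤ c := by
    have h1 : (x : ℝ) ^ d - (θ * y) ^ d = c / a := by
      rw [mul_pow, hθd]; field_simp; linarith
    have h2 : (c : ℝ) / a ≤ c := div_le_self (by linarith) ha1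
    have h3 : 0 < (c : ℝ) / a := by positivity
    exact sub_mul_sq_le hd hxR (by positivity) (by linarith) (by linarith)
  have hδ' : (x : ℝ) - θ * y ≤ c / x ^ 2 := by rwa [le_div_iff₀ (by positivity)]
  refine Nat.cast_le.mp ((hB x hxR fun r => ?_).trans (Nat.le_ceil B))
  have hone : ∀ s, p s * x₀ * y ≠ q s * y₀ * x →
      1 ≤ 864 * c * x₀ * a * x * (E / N) ^ s + 8 * y₀ * c * (E * N) ^ s / x ^ 2 := by
    intro s hs
    have h1 : (1 : ℝ) ≤ |((p s * x₀ * y - q s * y₀ * x : ℤ) : ℝ)| := by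
      exact_mod_cast Int.one_le_abs (sub_ne_zero.mpr hs)
    have h2 : ((p s * x₀ * y - q s * y₀ * x : ℤ) : ℝ)
        = -((q s * (θ * y₀) - p s * x₀) * y) - q s * y₀ * (x - θ * y) := by
      push_cast; ring
    rw [h2] at h1
    refine h1.trans ((abs_sub _ _).trans (add_le_add ?_ ?_))
    · rw [abs_neg, abs_mul, Nat.abs_cast]
      calc |(q s : ℝ) * (θ * y₀) - p s * x₀| * y
          ≤ 864 * c * x₀ * (E / N) ^ s * (a * x) := by
            gcongr
            exact hrem s
        _ = _ := by ring
    · rw [abs_mul, abs_mul, Nat.abs_cast, abs_of_nonneg hδ0]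
      calc |(q s : ℝ)| * y₀ * (x - θ * y) ≤ 8 * (E * N) ^ s * y₀ * (c / x ^ 2) := by
            gcongr
            exact hqabs s
        _ = _ := by ring
  have hEN1 : E / N ≤ 1 := (div_le_one hN0).mpr hEN.le
  have hENmul : 1 ≤ E * N := one_le_mul_of_one_le_of_one_le hE1 (by linarith)
  have hstep : ∀ s, r ≤ s → s ≤ r + 1 → p s * x₀ * y ≠ q s * y₀ * x →
      1 ≤ 864 * c * x₀ * a * x * (E / N) ^ r + 8 * y₀ * c * (E * N) ^ (r + 1) / x ^ 2 := by
    intro s hrs hsr hs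
    refine (hone s hs).trans (add_le_add ?_ ?_)
    · exact mul_le_mul_of_nonneg_left (pow_le_pow_of_le_one (by positivity) hEN1 hrs)
        (by positivity)
    · exact div_le_div_of_nonneg_right
        (mul_le_mul_of_nonneg_left (pow_le_pow_right₀ hENmul hsr) (by positivity)) (by positivity)
  by_cases hs : p r * x₀ * y = q r * y₀ * x
  · have hs' : p (r + 1) * x₀ * y ≠ q (r + 1) * y₀ * x := by
      intro h
      refine hdet r ?_
      have hne : ((y₀ : ℤ) * x * x₀ * y) ≠ 0 := by positivity
      refine mul_right_cancel₀ hne ?_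
      linear_combination (q r * y₀ * x) * h - (q (r + 1) * y₀ * x) * hs
    exact hstep (r + 1) (by omega) (by omega) hs'
  · exact hstep r le_rfl (by omega) hs

/-- **Thue's theorem** for binomial forms. -/
theorem finite_setOf_thue {d a b c : ℕ} (hd : 3 ≤ d) (ha : 0 < a) (hb : 0 < b) (hc : 0 < c) :
    {z : ℕ × ℕ | a * z.1 ^ d = b * z.2 ^ d + c}.Finite := by
  suffices h : ∃ B : ℕ, ∀ x y : ℕ, a * x ^ d = b * y ^ d + c → x ≤ B by
    obtain ⟨B, hB⟩ := h
    refine (Set.finite_Iic (B, a * B ^ d)).subset fun z hz => ?_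
    have h1 := hB z.1 z.2 hz
    have h2 : z.2 ≤ a * B ^ d := by
      calc z.2 ≤ z.2 ^ d := Nat.le_self_pow (by omega) _
        _ ≤ b * z.2 ^ d := Nat.le_mul_of_pos_left _ hb
        _ ≤ a * z.1 ^ d := by rw [Set.mem_ofPred_eq] at hz; omega
        _ ≤ a * B ^ d := by gcongr
    exact ⟨h1, h2⟩
  set L := c + (216 * d ^ 2 * c ^ 2) ^ 3 with hL
  have hle : ∀ x : ℕ, x ≤ a * x ^ d := fun x =>
    (Nat.le_self_pow (by omega) x).trans (Nat.le_mul_of_pos_left _ ha)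
  by_cases hex : ∃ x y : ℕ, L < x ∧ a * x ^ d = b * y ^ d + c
  · obtain ⟨x₀, y₀, hx₀, hsol⟩ := hex
    have h1 := hle x₀
    have hy : ∀ x y : ℕ, L < x → a * x ^ d = b * y ^ d + c → 0 < y := by
      intro x y hx h
      rcases Nat.eq_zero_or_pos y with rfl | h'
      · rw [zero_pow (by omega)] at h
        have := hle x
        omega
      · exact h'
    obtain ⟨B, hB⟩ := thue_bounded hd ha hb hc (hy _ _ hx₀ hsol) hsol (by omega)
    refine ⟨max L B, fun x y h => ?_⟩
    rcases le_or_gt x L with hx | hx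
    · exact le_max_of_le_left hx
    · exact le_max_of_le_right (hB x y (hy x y hx h) h)
  · push Not at hex
    exact ⟨L, fun x y h => by by_contra! hx; exact hex x y hx h⟩

open scoped Nat in
lemma exists_eq_mul_pow_of_dvd_factorization {k D n : ℕ} (hD : D ≠ 0) (hn : n ≠ 0)
    (h : ∀ p, p.Prime → k < p → D ∣ n.factorization p) :
    ∃ a x, a ∣ k ! ^ D ∧ n = a * x ^ D := by
  induction n using Nat.strong_induction_on with
  | _ n ih =>
  by_cases hex : ∃ p, p.Prime ∧ p ^ D ∣ n
  · obtain ⟨p, hp, m, rfl⟩ := hex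
    have hm : m ≠ 0 := right_ne_zero_of_mul hn
    have hpD : p ^ D ≠ 0 := pow_ne_zero _ hp.ne_zero
    have hlt : m < p ^ D * m :=
      lt_mul_of_one_lt_left (Nat.pos_of_ne_zero hm) (Nat.one_lt_pow hD hp.one_lt)
    obtain ⟨a, x, ha, hax⟩ := ih m hlt hm fun q hq hkq => by
      have h1 := h q hq hkq
      rw [Nat.factorization_mul hpD hm, Nat.factorization_pow, Finsupp.add_apply,
        Finsupp.smul_apply, smul_eq_mul] at h1
      exact (Nat.dvd_add_right (dvd_mul_right _ _)).mp h1
    exact ⟨a, p * x, ha, by rw [hax, mul_pow]; ring⟩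
  · push Not at hex
    refine ⟨n, 1, ?_, by simp⟩
    rw [← Nat.factorization_prime_le_iff_dvd hn (pow_ne_zero _ k.factorial_ne_zero)]
    intro p hp
    have h1 : n.factorization p < D := by
      by_contra! hle
      exact hex p hp ((hp.pow_dvd_iff_le_factorization hn).mpr hle)
    rw [Nat.factorization_pow, Finsupp.smul_apply, smul_eq_mul]
    rcases le_or_gt p k with hpk | hpk
    · have h2 : 0 < (k !).factorization p :=
        hp.factorization_pos_of_dvd k.factorial_ne_zero ((hp.dvd_factorial).mpr hpk)
      nlinarith
    · rw [Nat.eq_zero_of_dvd_of_lt (h p hp hpk) h1]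
      exact Nat.zero_le _

lemma finite_setOf_dvd_factorization (k : ℕ) {D c : ℕ} (hD : 3 ≤ D) (hc : 0 < c) :
    {n : ℕ | c < n ∧ ∀ p, p.Prime → k < p →
      D ∣ n.factorization p ∧ D ∣ (n - c).factorization p}.Finite := by
  open scoped Nat in
  refine Set.Finite.subset (s := ⋃ a ∈ (k ! ^ D).divisors, ⋃ b ∈ (k ! ^ D).divisors,
    (fun z : ℕ × ℕ => a * z.1 ^ D) '' {z : ℕ × ℕ | a * z.1 ^ D = b * z.2 ^ D + c}) ?_ ?_
  · refine Set.Finite.biUnion (Finset.finite_toSet _) fun a ha => ?_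
    refine Set.Finite.biUnion (Finset.finite_toSet _) fun b hb => ?_
    exact (finite_setOf_thue hD (Nat.pos_of_mem_divisors ha) (Nat.pos_of_mem_divisors hb)
      hc).image _
  · rintro n ⟨hcn, hn⟩
    have hk : k.factorial ^ D ≠ 0 := pow_ne_zero _ k.factorial_ne_zero
    obtain ⟨a, x, ha, hax⟩ := exists_eq_mul_pow_of_dvd_factorization (by omega)
      (show n ≠ 0 by omega) fun p hp hkp => (hn p hp hkp).1
    obtain ⟨b, y, hb, hby⟩ := exists_eq_mul_pow_of_dvd_factorization (by omega)
      (show n - c ≠ 0 by omega) fun p hp hkp => (hn p hp hkp).2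
    simp only [Set.mem_iUnion]
    exact ⟨a, Nat.mem_divisors.mpr ⟨ha, hk⟩, b, Nat.mem_divisors.mpr ⟨hb, hk⟩, (x, y),
      show a * x ^ D = b * y ^ D + c by omega, hax.symm⟩

/-- The size of the `i`-th term of `f` with respect to a `p`-adic slope; its largest values lie on
one edge of the Newton polygon of `f`. -/
noncomputable def slopeNorm (p A : ℕ) (B : ℤ) (f : Polynomial ℚ) (i : ℕ) : ℚ :=
  padicNorm p (f.coeff i) ^ A * (p : ℚ) ^ (B * i)

section SlopeNorm

open Polynomial

variable {p A : ℕ} {B : ℤ}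

lemma slopeNorm_nonneg (f : ℚ[X]) (i : ℕ) : 0 ≤ slopeNorm p A B f i :=
  mul_nonneg (pow_nonneg (padicNorm.nonneg _) _) (by positivity)

lemma slopeNorm_eq_zero (hA : A ≠ 0) {f : ℚ[X]} {i : ℕ} (h : f.coeff i = 0) :
    slopeNorm p A B f i = 0 := by
  simp [slopeNorm, h, hA]

variable [hp : Fact p.Prime]

lemma slopeNorm_eq_zpow {f : ℚ[X]} {i : ℕ} (h : f.coeff i ≠ 0) :
    slopeNorm p A B f i = (p : ℚ) ^ (B * i - A * padicValRat p (f.coeff i)) := by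
  have hp0 : (p : ℚ) ≠ 0 := by exact_mod_cast hp.out.ne_zero
  rw [slopeNorm, padicNorm.eq_zpow_of_nonzero h, ← zpow_natCast, ← zpow_mul, ← zpow_add₀ hp0]
  congr 1
  ring

lemma slopeNorm_mul_slopeNorm (g h : ℚ[X]) (i j : ℕ) :
    slopeNorm p A B g i * slopeNorm p A B h j =
      padicNorm p (g.coeff i * h.coeff j) ^ A * (p : ℚ) ^ (B * (i + j : ℕ)) := by
  have hp0 : (p : ℚ) ≠ 0 := by exact_mod_cast hp.out.ne_zero
  rw [slopeNorm, slopeNorm, padicNorm.mul, mul_pow, Nat.cast_add, mul_add, zpow_add₀ hp0]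
  ring

lemma exists_slopeNorm_mul_le (g h : ℚ[X]) (s : ℕ) :
    ∃ i j, i + j = s ∧ slopeNorm p A B (g * h) s ≤ slopeNorm p A B g i * slopeNorm p A B h j := by
  obtain ⟨z, hz, hmax⟩ := Finset.exists_max_image (Finset.HasAntidiagonal.antidiagonal s)
    (fun z => padicNorm p (g.coeff z.1 * h.coeff z.2)) ⟨(0, s), by simp⟩
  have hz' := Finset.HasAntidiagonal.mem_antidiagonal.mp hz
  refine ⟨z.1, z.2, hz', ?_⟩
  rw [slopeNorm_mul_slopeNorm, hz', slopeNorm, coeff_mul]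
  refine mul_le_mul_of_nonneg_right (pow_le_pow_left₀ (padicNorm.nonneg _) ?_ _) (by positivity)
  exact padicNorm.sum_le ⟨z, hz⟩ hmax

lemma slopeNorm_mul_eq {g h : ℚ[X]} {i j : ℕ} (hA : A ≠ 0)
    (hpos : 0 < slopeNorm p A B g i * slopeNorm p A B h j)
    (hlt : ∀ i' j', i' + j' = i + j → (i', j') ≠ (i, j) →
      slopeNorm p A B g i' * slopeNorm p A B h j' < slopeNorm p A B g i * slopeNorm p A B h j) :
    slopeNorm p A B (g * h) (i + j) = slopeNorm p A B g i * slopeNorm p A B h j := by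
  have hp0 : (0 : ℚ) < p := by exact_mod_cast hp.out.pos
  have hmem : (i, j) ∈ Finset.HasAntidiagonal.antidiagonal (i + j) := by simp
  rw [slopeNorm_mul_slopeNorm, slopeNorm, coeff_mul, ← Finset.add_sum_erase _ _ hmem]
  have h0 : 0 < padicNorm p (g.coeff i * h.coeff j) := by
    refine lt_of_le_of_ne (padicNorm.nonneg _) fun h0 => hpos.ne' ?_
    rw [slopeNorm_mul_slopeNorm, ← h0, zero_pow hA, zero_mul]
  have h1 : padicNorm p (∑ z ∈ (Finset.HasAntidiagonal.antidiagonal (i + j)).erase (i, j),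
      g.coeff z.1 * h.coeff z.2) < padicNorm p (g.coeff i * h.coeff j) := by
    refine padicNorm.sum_lt' (fun z hz => ?_) h0
    rw [Finset.mem_erase, Finset.HasAntidiagonal.mem_antidiagonal] at hz
    have h2 := hlt z.1 z.2 hz.2 hz.1
    rw [slopeNorm_mul_slopeNorm, slopeNorm_mul_slopeNorm, hz.2] at h2
    exact lt_of_pow_lt_pow_left₀ _ (padicNorm.nonneg _)
      (lt_of_mul_lt_mul_right h2 (by positivity))
  rw [padicNorm.add_eq_max_of_ne h1.ne', max_eq_left h1.le]

lemma exists_slopeNorm_argmax (hA : A ≠ 0) {g : ℚ[X]} (hg : g ≠ 0) :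
    ∃ i₀ i₁, i₀ ≤ i₁ ∧ i₁ ≤ g.natDegree ∧ 0 < slopeNorm p A B g i₀ ∧
      slopeNorm p A B g i₁ = slopeNorm p A B g i₀ ∧
      (∀ i, slopeNorm p A B g i ≤ slopeNorm p A B g i₀) ∧
      (∀ i < i₀, slopeNorm p A B g i < slopeNorm p A B g i₀) ∧
      ∀ i > i₁, slopeNorm p A B g i < slopeNorm p A B g i₀ := by
  have hp0 : (0 : ℚ) < p := by exact_mod_cast hp.out.pos
  set d := g.natDegree with hd
  obtain ⟨m, hm, hmax⟩ := Finset.exists_max_image (Finset.range (d + 1))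
    (slopeNorm p A B g) ⟨0, by simp⟩
  have hpos : 0 < slopeNorm p A B g m := by
    refine lt_of_lt_of_le ?_ (hmax d (by simp))
    rw [slopeNorm_eq_zpow (by rwa [hd, coeff_natDegree, leadingCoeff_ne_zero])]
    positivity
  have hbig : ∀ i > d, slopeNorm p A B g i < slopeNorm p A B g m := fun i hi => by
    rwa [slopeNorm_eq_zero hA (coeff_eq_zero_of_natDegree_lt hi)]
  have hall : ∀ i, slopeNorm p A B g i ≤ slopeNorm p A B g m := fun i => by
    rcases le_or_gt i d with h | h
    · exact hmax i (by simp; omega)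
    · exact (hbig i h).le
  set S := (Finset.range (d + 1)).filter fun i => slopeNorm p A B g i = slopeNorm p A B g m
  have hmS : m ∈ S := Finset.mem_filter.mpr ⟨hm, rfl⟩
  have hS : ∀ i, i ∉ S → slopeNorm p A B g i < slopeNorm p A B g m := fun i hi => by
    refine lt_of_le_of_ne (hall i) fun h => ?_
    have hid : i ≤ d := by
      by_contra! hlt
      exact (hbig i hlt).ne h
    exact hi (Finset.mem_filter.mpr ⟨by simp; omega, h⟩)
  have h0 := Finset.mem_filter.mp (S.min'_mem ⟨m, hmS⟩)
  have h1 := Finset.mem_filter.mp (S.max'_mem ⟨m, hmS⟩)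
  refine ⟨S.min' ⟨m, hmS⟩, S.max' ⟨m, hmS⟩, S.min'_le _ (S.max'_mem _), ?_, ?_⟩
  · have := Finset.mem_range.mp h1.1
    omega
  · rw [h0.2, h1.2]
    refine ⟨hpos, rfl, hall, fun i hi => hS i fun h => ?_, fun i hi => hS i fun h => ?_⟩
    · exact absurd (S.min'_le _ h) (not_le.mpr hi)
    · exact absurd (S.le_max' _ h) (not_le.mpr hi)

lemma dvd_of_slopeNorm_eq {g : ℚ[X]} {i₀ i₁ : ℕ} (hA : A ≠ 0) (hpos : 0 < slopeNorm p A B g i₀)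
    (h : slopeNorm p A B g i₁ = slopeNorm p A B g i₀) : (A : ℤ) ∣ B * ((i₁ : ℤ) - i₀) := by
  have hp1 : (1 : ℚ) < p := by exact_mod_cast hp.out.one_lt
  have h0 : g.coeff i₀ ≠ 0 := fun h' => hpos.ne' (slopeNorm_eq_zero hA h')
  have h1 : g.coeff i₁ ≠ 0 := fun h' => (h ▸ hpos).ne' (slopeNorm_eq_zero hA h')
  rw [slopeNorm_eq_zpow h0, slopeNorm_eq_zpow h1] at h
  have h2 := zpow_right_injective₀ (by linarith) hp1.ne' h
  exact ⟨padicValRat p (g.coeff i₁) - padicValRat p (g.coeff i₀), by linear_combination h2⟩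

/-- If the terms of `g * h` of largest slope norm are the `u`-th and the `t`-th one, then the
corresponding edge of the Newton polygon is made of edges of those of `g` and `h`. -/
lemma exists_slope_decomposition (hA : A ≠ 0) {g h : ℚ[X]} (hg : g ≠ 0) (hh : h ≠ 0) {u t : ℕ}
    (hut : u < t) (heq : slopeNorm p A B (g * h) t = slopeNorm p A B (g * h) u)
    (hlt : ∀ s, s ≠ u → s ≠ t → slopeNorm p A B (g * h) s < slopeNorm p A B (g * h) u) :
    ∃ i₀ i₁ j₀ j₁, i₀ ≤ i₁ ∧ i₁ ≤ g.natDegree ∧ j₀ ≤ j₁ ∧ j₁ ≤ h.natDegree ∧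
      i₀ + j₀ = u ∧ i₁ + j₁ = t ∧
      (A : ℤ) ∣ B * ((i₁ : ℤ) - i₀) ∧ (A : ℤ) ∣ B * ((j₁ : ℤ) - j₀) := by
  obtain ⟨i₀, i₁, hi, hid, hgpos, hgeq, hgmax, hglt, hggt⟩ :=
    exists_slopeNorm_argmax (p := p) (B := B) hA hg
  obtain ⟨j₀, j₁, hj, hjd, hhpos, hheq, hhmax, hhlt, hhgt⟩ :=
    exists_slopeNorm_argmax (p := p) (B := B) hA hh
  have hle : ∀ s, slopeNorm p A B (g * h) s ≤ slopeNorm p A B g i₀ * slopeNorm p A B h j₀ := by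
    intro s
    obtain ⟨i, j, -, hij⟩ := exists_slopeNorm_mul_le (p := p) (A := A) (B := B) g h s
    exact hij.trans (mul_le_mul (hgmax i) (hhmax j) (slopeNorm_nonneg _ _) hgpos.le)
  have hprod : ∀ i j, (slopeNorm p A B g i < slopeNorm p A B g i₀ ∨
      slopeNorm p A B h j < slopeNorm p A B h j₀) →
      slopeNorm p A B g i * slopeNorm p A B h j <
        slopeNorm p A B g i₀ * slopeNorm p A B h j₀ := by
    rintro i j (h' | h')
    · exact (mul_le_mul_of_nonneg_left (hhmax j) (slopeNorm_nonneg _ _)).trans_lt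
        (mul_lt_mul_of_pos_right h' hhpos)
    · exact mul_lt_mul' (hgmax i) h' (slopeNorm_nonneg _ _) hgpos
  have hout : ∀ s, (s < i₀ + j₀ ∨ i₁ + j₁ < s) →
      slopeNorm p A B (g * h) s < slopeNorm p A B g i₀ * slopeNorm p A B h j₀ := by
    intro s hs
    obtain ⟨i, j, hij, hle'⟩ := exists_slopeNorm_mul_le (p := p) (A := A) (B := B) g h s
    refine hle'.trans_lt (hprod i j ?_)
    rcases hs with hs | hs
    · rcases lt_or_ge i i₀ with hi' | hi'
      · exact Or.inl (hglt i hi')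
      · exact Or.inr (hhlt j (by omega))
    · rcases lt_or_ge i₁ i with hi' | hi'
      · exact Or.inl (hggt i hi')
      · exact Or.inr (hhgt j (by omega))
  have heq₀ : slopeNorm p A B (g * h) (i₀ + j₀) =
      slopeNorm p A B g i₀ * slopeNorm p A B h j₀ := by
    refine slopeNorm_mul_eq hA (mul_pos hgpos hhpos) fun i j hij hne => hprod i j ?_
    rcases lt_trichotomy i i₀ with hi' | rfl | hi'
    · exact Or.inl (hglt i hi')
    · exact absurd (by rw [Nat.add_left_cancel hij]) hne
    · exact Or.inr (hhlt j (by omega))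
  have heq₁ : slopeNorm p A B (g * h) (i₁ + j₁) =
      slopeNorm p A B g i₀ * slopeNorm p A B h j₀ := by
    rw [← hgeq, ← hheq]
    refine slopeNorm_mul_eq hA (by rw [hgeq, hheq]; exact mul_pos hgpos hhpos)
      fun i j hij hne => ?_
    rw [hgeq, hheq]
    refine hprod i j ?_
    rcases lt_trichotomy i i₁ with hi' | rfl | hi'
    · exact Or.inr (hhgt j (by omega))
    · exact absurd (by rw [Nat.add_left_cancel hij]) hne
    · exact Or.inl (hggt i hi')
  have hmem : ∀ s, slopeNorm p A B (g * h) s = slopeNorm p A B g i₀ * slopeNorm p A B h j₀ →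
      s = u ∨ s = t := by
    intro s hs
    by_contra! hcon
    exact absurd (hs ▸ hlt s hcon.1 hcon.2) (not_lt.mpr (hle u))
  have hmax : slopeNorm p A B (g * h) u = slopeNorm p A B g i₀ * slopeNorm p A B h j₀ := by
    rcases hmem _ heq₀ with h' | h'
    · rw [← h', heq₀]
    · rw [← heq, ← h', heq₀]
  have hu : ¬(u < i₀ + j₀ ∨ i₁ + j₁ < u) := fun h' => (hout u h').ne hmax
  have ht : ¬(t < i₀ + j₀ ∨ i₁ + j₁ < t) := fun h' => (hout t h').ne (heq.trans hmax)
  have h₀ := hmem _ heq₀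
  have h₁ := hmem _ heq₁
  exact ⟨i₀, i₁, j₀, j₁, hi, hid, hj, hjd, by omega, by omega,
    dvd_of_slopeNorm_eq hA hgpos hgeq, dvd_of_slopeNorm_eq hA hhpos hheq⟩

end SlopeNorm

section Truncation

open Polynomial

/-- The truncation at degree `k` of the binomial expansion of `(1 + X) ^ n`. -/
noncomputable def truncatedBinomial (n k : ℕ) : ℚ[X] :=
  ∑ j ∈ Finset.range (k + 1), C ((n.choose j : ℚ)) * X ^ j

lemma coeff_truncatedBinomial (n k j : ℕ) :
    (truncatedBinomial n k).coeff j = if j ≤ k then (n.choose j : ℚ) else 0 := by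
  simp [truncatedBinomial, coeff_X_pow]

lemma natDegree_truncatedBinomial {n k : ℕ} (h : k ≤ n) :
    (truncatedBinomial n k).natDegree = k := by
  refine natDegree_eq_of_le_of_coeff_ne_zero ?_ ?_
  · rw [natDegree_le_iff_coeff_eq_zero]
    intro j hj
    rw [coeff_truncatedBinomial, if_neg (by omega)]
  · rw [coeff_truncatedBinomial, if_pos le_rfl]
    exact_mod_cast (Nat.choose_pos h).ne'

lemma coeff_taylor_truncatedBinomial {n k j : ℕ} (hjk : j ≤ k) (hkn : k < n) :
    (taylor (-1) (truncatedBinomial n k)).coeff j =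
      (-1) ^ (k - j) * (n.choose j * (n - j - 1).choose (k - j) : ℕ) := by
  have h1 : (taylor (-1) (truncatedBinomial n k)).coeff j =
      ∑ i ∈ Finset.range (k + 1), ((i.choose j : ℚ) * n.choose i) * (-1) ^ (i - j) := by
    rw [taylor_coeff, truncatedBinomial, map_sum, eval_finsetSum]
    refine Finset.sum_congr rfl fun i _ => ?_
    rw [C_mul_X_pow_eq_monomial, hasseDeriv_monomial, eval_monomial]
  have h2 : ∑ i ∈ Finset.range (k + 1), ((i.choose j : ℚ) * n.choose i) * (-1) ^ (i - j) =
      ∑ l ∈ Finset.range (k - j + 1), (n.choose j : ℚ) * ((-1) ^ l * (n - j).choose l) := by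
    rw [show k + 1 = j + (k - j + 1) by omega, Finset.sum_range_add,
      Finset.sum_eq_zero, zero_add]
    · refine Finset.sum_congr rfl fun l _ => ?_
      have h := Nat.choose_mul (n := n) (show j ≤ j + l by omega)
      rw [Nat.add_sub_cancel_left] at h ⊢
      have h' : (n.choose (j + l) : ℚ) * (j + l).choose j = n.choose j * (n - j).choose l := by
        exact_mod_cast h
      linear_combination (-1) ^ l * h'
    · intro i hi
      rw [Nat.choose_eq_zero_of_lt (Finset.mem_range.mp hi)]
      simp
  have h3 := Int.alternating_sum_range_choose_eq_choose (n := n - j - 1) (m := k - j)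
  rw [show n - j - 1 + 1 = n - j by omega] at h3
  have h4 : ∑ l ∈ Finset.range (k - j + 1), (-1) ^ l * ((n - j).choose l : ℚ) =
      (-1) ^ (k - j) * (n - j - 1).choose (k - j) := by exact_mod_cast h3
  rw [h1, h2, ← Finset.mul_sum, h4]
  push_cast
  ring

open scoped Nat in
lemma mul_choose_mul_choose_eq_descFactorial {n k j : ℕ} (hjk : j ≤ k) (hkn : k < n) :
    (n - j) * (j ! * (k - j)! * (n.choose j * (n - j - 1).choose (k - j))) =
      n.descFactorial (k + 1) := by
  have h1 := Nat.descFactorial_mul_descFactorial (n := n) (show j ≤ k + 1 by omega)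
  obtain ⟨r, hr⟩ : ∃ r, n - j = r + 1 := ⟨n - j - 1, by omega⟩
  rw [← h1, show k + 1 - j = k - j + 1 by omega, hr, Nat.succ_descFactorial_succ,
    Nat.add_sub_cancel, Nat.descFactorial_eq_factorial_mul_choose,
    Nat.descFactorial_eq_factorial_mul_choose]
  ring

lemma padicNorm_natCast_eq_one {p m : ℕ} [Fact p.Prime] (h : ¬p ∣ m) :
    padicNorm p (m : ℚ) = 1 :=
  (padicNorm.nat_eq_one_iff m).mpr h

lemma padicNorm_coeff_taylor_truncatedBinomial {p n k j c : ℕ} [hp : Fact p.Prime] (hkp : k < p)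
    (hkn : k < n) (hck : c ≤ k) (hdvd : p ∣ n - c) (hjk : j ≤ k) :
    padicNorm p ((taylor (-1) (truncatedBinomial n k)).coeff j) =
      if j = c then 1 else padicNorm p ((n - c : ℕ) : ℚ) := by
  have hother : ∀ i ≤ k, i ≠ c → padicNorm p ((n - i : ℕ) : ℚ) = 1 := by
    intro i hik hic
    refine padicNorm_natCast_eq_one fun h => ?_
    rcases lt_or_gt_of_ne hic with hlt | hlt
    · have := Nat.dvd_sub h hdvd
      exact Nat.not_dvd_of_pos_of_lt (by omega) (by omega) this
    · have := Nat.dvd_sub hdvd h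
      exact Nat.not_dvd_of_pos_of_lt (by omega) (by omega) this
  have hdesc : padicNorm p (n.descFactorial (k + 1) : ℚ) = padicNorm p ((n - c : ℕ) : ℚ) := by
    rw [Nat.descFactorial_eq_prod_range,
      ← Finset.mul_prod_erase _ _ (Finset.mem_range.mpr (Nat.lt_succ_of_le hck)), Nat.cast_mul,
      padicNorm.mul, Nat.cast_prod]
    refine (congrArg _ ?_).trans (mul_one _)
    refine Finset.prod_induction _ (fun x => padicNorm p x = 1)
      (fun x y hx hy => by rw [padicNorm.mul, hx, hy, one_mul]) padicNorm.one fun i hi => ?_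
    rw [Finset.mem_erase, Finset.mem_range] at hi
    exact hother i (by omega) hi.1
  have hfact : ∀ i ≤ k, padicNorm p (i.factorial : ℚ) = 1 := fun i hi =>
    padicNorm_natCast_eq_one fun h => by
      have := hp.out.dvd_factorial.mp h
      omega
  have hmul := mul_choose_mul_choose_eq_descFactorial hjk hkn
  have hnorm : padicNorm p ((n - j : ℕ) : ℚ) *
      padicNorm p ((taylor (-1) (truncatedBinomial n k)).coeff j) =
        padicNorm p ((n - c : ℕ) : ℚ) := by
    rw [← hdesc, ← hmul, coeff_taylor_truncatedBinomial hjk hkn]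
    generalize n.choose j * (n - j - 1).choose (k - j) = m
    push_cast
    simp only [padicNorm.mul, hfact _ hjk, hfact _ (Nat.sub_le k j), one_mul]
    rcases neg_one_pow_eq_or ℚ (k - j) with h | h <;> simp [h]
  split_ifs with hjc
  · subst hjc
    refine mul_left_cancel₀ ?_ (hnorm.trans (mul_one _).symm)
    exact padicNorm.nonzero (by exact_mod_cast (show n - j ≠ 0 by omega))
  · rwa [hother j hjk hjc, one_mul] at hnorm

end Truncation

section Slopes

open Polynomial

variable {p k c e : ℕ} [hp : Fact p.Prime] {g h : ℚ[X]}

lemma slopeNorm_eq_zpow_of_padicNorm {A : ℕ} {B E : ℤ} {f : ℚ[X]} {j : ℕ}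
    (h : padicNorm p (f.coeff j) = (p : ℚ) ^ E) :
    slopeNorm p A B f j = (p : ℚ) ^ (A * E + B * j) := by
  have hp0 : (p : ℚ) ≠ 0 := by exact_mod_cast hp.out.ne_zero
  rw [slopeNorm, h, ← zpow_natCast, ← zpow_mul, ← zpow_add₀ hp0]
  congr 1
  ring

lemma exists_dvd_of_coeff_right (he : e ≠ 0) (hck : c < k) (hgh : g * h ≠ 0)
    (hdeg : (g * h).natDegree = k)
    (hcoeff : ∀ j ≤ k, padicNorm p ((g * h).coeff j) = if j = c then 1 else (p : ℚ) ^ (-(e : ℤ))) :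
    ∃ i j, i + j = c ∧ ((k - c : ℕ) : ℤ) ∣ e * ((g.natDegree : ℤ) - i) ∧
      ((k - c : ℕ) : ℤ) ∣ e * ((h.natDegree : ℤ) - j) := by
  have hp1 : (1 : ℚ) < p := by exact_mod_cast hp.out.one_lt
  have hg := left_ne_zero_of_mul hgh
  have hh := right_ne_zero_of_mul hgh
  have hA : k - c ≠ 0 := by omega
  have hnc : slopeNorm p (k - c) e (g * h) c = (p : ℚ) ^ ((e : ℤ) * c) := by
    rw [slopeNorm_eq_zpow_of_padicNorm (E := 0) (by rw [hcoeff c hck.le, if_pos rfl, zpow_zero])]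
    simp
  have hnj : ∀ j ≤ k, j ≠ c →
      slopeNorm p (k - c) e (g * h) j = (p : ℚ) ^ ((e : ℤ) * c + e * ((j : ℤ) - k)) := by
    intro j hjk hjc
    rw [slopeNorm_eq_zpow_of_padicNorm (E := -(e : ℤ)) (by rw [hcoeff j hjk, if_neg hjc])]
    congr 1
    push_cast [Nat.cast_sub hck.le]
    ring
  obtain ⟨i₀, i₁, j₀, j₁, -, hi, -, hj, hu, ht, hgd, hhd⟩ :=
    exists_slope_decomposition (p := p) (B := e) hA hg hh hck
      (by rw [hnj k le_rfl hck.ne', hnc]; simp) (fun s hsc hsk => by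
        rw [hnc]
        rcases le_or_gt s k with h' | h'
        · rw [hnj s h' hsc]
          refine zpow_lt_zpow_right₀ hp1 ?_
          have h1 : (0 : ℤ) < e := by omega
          have h2 : (s : ℤ) - k < 0 := by omega
          nlinarith
        · rw [slopeNorm_eq_zero hA (coeff_eq_zero_of_natDegree_lt (by omega))]
          positivity)
  rw [natDegree_mul hg hh] at hdeg
  obtain rfl : i₁ = g.natDegree := by omega
  obtain rfl : j₁ = h.natDegree := by omega
  exact ⟨i₀, j₀, hu, hgd, hhd⟩

lemma exists_dvd_of_coeff_left (he : e ≠ 0) (hc : 0 < c) (hck : c ≤ k) (hgh : g * h ≠ 0)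
    (hdeg : (g * h).natDegree = k)
    (hcoeff : ∀ j ≤ k, padicNorm p ((g * h).coeff j) = if j = c then 1 else (p : ℚ) ^ (-(e : ℤ))) :
    ∃ i j, i ≤ g.natDegree ∧ j ≤ h.natDegree ∧ i + j = c ∧ c ∣ e * i ∧ c ∣ e * j := by
  have hp1 : (1 : ℚ) < p := by exact_mod_cast hp.out.one_lt
  have hg := left_ne_zero_of_mul hgh
  have hh := right_ne_zero_of_mul hgh
  have hnc : slopeNorm p c (-(e : ℤ)) (g * h) c = (p : ℚ) ^ (-((e : ℤ) * c)) := by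
    rw [slopeNorm_eq_zpow_of_padicNorm (E := 0) (by rw [hcoeff c hck, if_pos rfl, zpow_zero])]
    simp
  have hnj : ∀ j ≤ k, j ≠ c →
      slopeNorm p c (-(e : ℤ)) (g * h) j = (p : ℚ) ^ (-((e : ℤ) * c) - e * j) := by
    intro j hjk hjc
    rw [slopeNorm_eq_zpow_of_padicNorm (E := -(e : ℤ)) (by rw [hcoeff j hjk, if_neg hjc])]
    congr 1
    ring
  have hn0 : slopeNorm p c (-(e : ℤ)) (g * h) 0 = (p : ℚ) ^ (-((e : ℤ) * c)) := by
    rw [hnj 0 (by omega) hc.ne]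
    simp
  obtain ⟨i₀, i₁, j₀, j₁, -, hi, -, hj, hu, ht, hgd, hhd⟩ :=
    exists_slope_decomposition (p := p) (B := -(e : ℤ)) hc.ne' hg hh hc
      (by rw [hn0, hnc]) (fun s hs0 hsc => by
        rw [hn0]
        rcases le_or_gt s k with h' | h'
        · rw [hnj s h' hsc]
          refine zpow_lt_zpow_right₀ hp1 ?_
          have h1 : (0 : ℤ) < e := by omega
          have h2 : (0 : ℤ) < s := by omega
          nlinarith
        · rw [slopeNorm_eq_zero hc.ne' (coeff_eq_zero_of_natDegree_lt (by omega))]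
          positivity)
  obtain ⟨rfl, rfl⟩ : i₀ = 0 ∧ j₀ = 0 := by omega
  refine ⟨i₁, j₁, hi, hj, ht, ?_, ?_⟩
  · simpa [← Int.natCast_dvd_natCast] using hgd
  · simpa [← Int.natCast_dvd_natCast] using hhd

end Slopes

section Factorization

open Polynomial

lemma dvd_factorization_of_eq_mul {n k : ℕ} {g h : ℚ[X]} (hkn : k < n)
    (hgh : g * h = taylor (-1) (truncatedBinomial n k)) :
    (∀ p, p.Prime → k < p → ∀ c < k, ∃ i j, i + j = c ∧
      ((k - c : ℕ) : ℤ) ∣ (n - c).factorization p * ((g.natDegree : ℤ) - i) ∧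
      ((k - c : ℕ) : ℤ) ∣ (n - c).factorization p * ((h.natDegree : ℤ) - j)) ∧
    (∀ p, p.Prime → k < p → ∀ c ≤ k, 0 < c → c ≤ g.natDegree + h.natDegree →
      ∃ i j, i ≤ g.natDegree ∧ j ≤ h.natDegree ∧ i + j = c ∧
      c ∣ (n - c).factorization p * i ∧ c ∣ (n - c).factorization p * j) := by
  have hdeg : (g * h).natDegree = k := by
    rw [hgh, natDegree_taylor, natDegree_truncatedBinomial hkn.le]
  have hcoeff : ∀ p, p.Prime → k < p → ∀ c ≤ k, (n - c).factorization p ≠ 0 → ∀ j ≤ k,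
      padicNorm p ((g * h).coeff j) =
        if j = c then 1 else (p : ℚ) ^ (-((n - c).factorization p : ℤ)) := by
    intro p hp hkp c hck he j hjk
    have : Fact p.Prime := ⟨hp⟩
    have hne : ((n - c : ℕ) : ℚ) ≠ 0 := by exact_mod_cast (show n - c ≠ 0 by omega)
    rw [hgh, padicNorm_coeff_taylor_truncatedBinomial hkp hkn hck
      (Nat.dvd_of_factorization_pos he) hjk, padicNorm.eq_zpow_of_nonzero hne,
      padicValRat.of_nat, Nat.factorization_def _ hp]
  have hne : 0 < k → g * h ≠ 0 := fun hk h0 => by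
    rw [h0, natDegree_zero] at hdeg
    omega
  refine ⟨fun p hp hkp c hck => ?_, fun p hp hkp c hck hc hcd => ?_⟩ <;>
    have : Fact p.Prime := ⟨hp⟩ <;>
    by_cases he : (n - c).factorization p = 0
  · exact ⟨0, c, zero_add c, by simp [he], by simp [he]⟩
  · exact exists_dvd_of_coeff_right he hck (hne (by omega)) hdeg (hcoeff p hp hkp c hck.le he)
  · exact ⟨min c g.natDegree, c - min c g.natDegree, by omega, by omega, by omega,
      by simp [he], by simp [he]⟩
  · exact exists_dvd_of_coeff_left he hc hck (hne (by omega)) hdeg (hcoeff p hp hkp c hck he)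

lemma dvd_factorization_of_not_irreducible {n k : ℕ} {g h : ℚ[X]} (hk : 3 ≤ k) (hkn : k < n)
    (hgh : g * h = taylor (-1) (truncatedBinomial n k))
    (hg : 0 < g.natDegree) (hh : 0 < h.natDegree) :
    (∃ D, 3 ≤ D ∧ D ≤ k ∧ ∀ p, p.Prime → k < p →
      D ∣ n.factorization p ∧ D ∣ (n - k).factorization p) ∨
    (4 ≤ k ∧ ∀ p, p.Prime → k < p →
      k - 1 ∣ (n - 1).factorization p ∧ k - 1 ∣ (n - 1 - (k - 2)).factorization p) := by
  obtain ⟨hright, hleft⟩ := dvd_factorization_of_eq_mul hkn hgh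
  have hdeg : g.natDegree + h.natDegree = k := by
    have h0 : g * h ≠ 0 := mul_ne_zero (ne_zero_of_natDegree_gt hg) (ne_zero_of_natDegree_gt hh)
    rw [← natDegree_mul (left_ne_zero_of_mul h0) (right_ne_zero_of_mul h0), hgh,
      natDegree_taylor, natDegree_truncatedBinomial hkn.le]
  have h0 : ∀ p, p.Prime → k < p → k ∣ n.factorization p * g.natDegree := by
    intro p hp hkp
    obtain ⟨i, j, hij, hi, -⟩ := hright p hp hkp 0 (by omega)
    obtain rfl : i = 0 := by omega
    simpa [← Int.natCast_dvd_natCast] using hi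
  have hk' : ∀ p, p.Prime → k < p → k ∣ (n - k).factorization p * g.natDegree := by
    intro p hp hkp
    obtain ⟨i, j, hi, hj, hij, hdvd, -⟩ := hleft p hp hkp k le_rfl (by omega) (by omega)
    obtain rfl : i = g.natDegree := by omega
    exact hdvd
  obtain ⟨D, m, hcop, hkD, hgm⟩ := Nat.exists_coprime k g.natDegree
  set t := k.gcd g.natDegree
  have ht : 0 < t := Nat.gcd_pos_of_pos_left _ (by omega)
  have hD : ∀ e, k ∣ e * g.natDegree → D ∣ e := by
    intro e he
    rw [hkD, hgm, ← mul_assoc] at he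
    exact hcop.dvd_of_dvd_mul_right (Nat.dvd_of_mul_dvd_mul_right ht he)
  by_cases hD3 : 3 ≤ D
  · exact Or.inl ⟨D, hD3, by rw [hkD]; exact Nat.le_mul_of_pos_right _ ht,
      fun p hp hkp => ⟨hD _ (h0 p hp hkp), hD _ (hk' p hp hkp)⟩⟩
  · right
    have hm : 0 < m := by
      by_contra! hm
      obtain rfl : m = 0 := by omega
      omega
    have hmD : m < D := by
      refine lt_of_mul_lt_mul_right (a := t) ?_ (Nat.zero_le t)
      omega
    obtain ⟨rfl, rfl⟩ : D = 2 ∧ m = 1 := by omega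
    have hcop' : (k - 1).Coprime g.natDegree := by
      have h1 : k - 1 + 1 = 2 * g.natDegree := by omega
      refine Nat.Coprime.coprime_dvd_right (Dvd.intro_left 2 h1.symm) ?_
      simp
    have hgh' : h.natDegree = g.natDegree := by omega
    refine ⟨by omega, fun p hp hkp => ⟨?_, ?_⟩⟩
    · obtain ⟨i, j, hij, hi, hj⟩ := hright p hp hkp 1 (by omega)
      refine hcop'.dvd_of_dvd_mul_right ?_
      rcases Nat.eq_zero_or_pos i with rfl | hi'
      · simpa [← Int.natCast_dvd_natCast] using hi
      · obtain rfl : j = 0 := by omega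
        rw [hgh'] at hj
        simpa [← Int.natCast_dvd_natCast] using hj
    · rw [show n - 1 - (k - 2) = n - (k - 1) by omega]
      obtain ⟨i, j, hi, hj, hij, hi', hj'⟩ :=
        hleft p hp hkp (k - 1) (by omega) (by omega) (by omega)
      refine hcop'.dvd_of_dvd_mul_right ?_
      rcases hi.eq_or_lt with rfl | hi''
      · exact hi'
      · obtain rfl : j = g.natDegree := by omega
        exact hj'

end Factorization

open Polynomial in
theorem eventually_irreducible_truncated_binomial (k : ℕ) (hk : 3 ≤ k) :
    ∃ n₀ : ℕ, ∀ n ≥ n₀,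
      Irreducible (∑ j ∈ Finset.range (k + 1), C ((n.choose j : ℚ)) * X ^ j) := by
  obtain ⟨N₁, hN₁⟩ := (Set.Finite.biUnion (Set.finite_Icc 3 k) fun D hD =>
    finite_setOf_dvd_factorization k hD.1 (show 0 < k by omega)).bddAbove
  obtain ⟨N₂, hN₂⟩ : ∃ N₂, 4 ≤ k → ∀ n, k - 2 < n → (∀ p, p.Prime → k < p →
      k - 1 ∣ n.factorization p ∧ k - 1 ∣ (n - (k - 2)).factorization p) → n ≤ N₂ := by
    by_cases hk4 : 4 ≤ k
    · obtain ⟨N, hN⟩ := (finite_setOf_dvd_factorization k (D := k - 1) (c := k - 2)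
        (by omega) (by omega)).bddAbove
      exact ⟨N, fun _ n hn h => hN ⟨hn, h⟩⟩
    · exact ⟨0, fun h => absurd h hk4⟩
  refine ⟨k + N₁ + N₂ + 2, fun n hn => ?_⟩
  have hkn : k < n := by omega
  change Irreducible (truncatedBinomial n k)
  rw [← MulEquiv.irreducible_iff (taylorEquiv (-1 : ℚ))]
  change Irreducible (taylor (-1) (truncatedBinomial n k))
  have hdeg : (taylor (-1) (truncatedBinomial n k)).natDegree = k := by
    rw [natDegree_taylor, natDegree_truncatedBinomial hkn.le]
  refine ⟨fun hunit => ?_, fun {g h} hgh => ?_⟩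
  · rw [natDegree_eq_zero_of_isUnit hunit] at hdeg
    omega
  by_contra! hcon
  have hne : g * h ≠ 0 := by
    rw [← hgh]
    exact ne_zero_of_natDegree_gt (n := 0) (by omega)
  have hpos : ∀ f : ℚ[X], f ≠ 0 → ¬IsUnit f → 0 < f.natDegree := by
    intro f hf hunit
    by_contra! h0
    refine hunit (isUnit_iff_degree_eq_zero.mpr ?_)
    rw [degree_eq_natDegree hf, Nat.le_zero.mp h0, Nat.cast_zero]
  rcases dvd_factorization_of_not_irreducible hk hkn hgh.symm
    (hpos g (left_ne_zero_of_mul hne) hcon.1) (hpos h (right_ne_zero_of_mul hne) hcon.2) with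
    ⟨D, hD3, hDk, hD⟩ | ⟨hk4, hD⟩
  · have := hN₁ (Set.mem_biUnion (show D ∈ Set.Icc 3 k from ⟨hD3, hDk⟩) ⟨hkn, hD⟩)
    omega
  · have := hN₂ hk4 (n - 1) (by omega) hD
    omega
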